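/- In the definition of ≲P3, restricting the universally quantified H to MINIMAL simplified activation sets does not change the defined relation: ⟨A1,L1⟩ ≲P3 ⟨A2,L2⟩ (where the quantification runs over all H ⊆ 𝔗_{Π∪Δ}) holds if and only if the same condition holds with H additionally required to be a minimal simplified activation set for ⟨A1,L1⟩. -/

import Mathlib

/-- A literal: an atom, possibly prefixed with negation. -/
inductive Lit (α : Type) : Type where
  | pos : α → Lit α
  | neg : α → Lit α
  deriving DecidableEq

/-- A (ground) rule: a head literal together with a finite (possibly empty)
conjunction of body literals.  A rule with empty body is just a literal. -/
structure Rule (α : Type) : Type where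
  head : Lit α
  body : Finset (Lit α)
  deriving DecidableEq

/-- View a set of literals as a set of bodiless rules. -/
def litRules {α : Type} (S : Set (Lit α)) : Set (Rule α) :=
  {r | r.head ∈ S ∧ r.body = ∅}

/-- The theory `𝔗_P` of a set of rules `P`: the least set of literals
containing the bodiless rules of `P` and closed under the rules of `P`. -/
inductive Th {α : Type} (P : Set (Rule α)) : Lit α → Prop where
  | step (r : Rule α) (hr : r ∈ P) (ih : ∀ l ∈ r.body, Th P l) : Th P r.head

/-- A set of rules is contradictory iff it derives both `A` and `¬A`
for some atom `A`. -/
def Contradictory {α : Type} (P : Set (Rule α)) : Prop :=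
  ∃ a : α, Th P (Lit.pos a) ∧ Th P (Lit.neg a)

/-- A defeasible specification `⟨Π^F, Π^G, Δ⟩`:
facts, general (strict) rules, and defeasible rules (all taken ground). -/
structure Spec (α : Type) : Type where
  F : Set (Lit α)
  G : Set (Rule α)
  D : Set (Rule α)

namespace Spec

variable {α : Type}

/-- `Π := Π^F ∪ Π^G`. -/
def strict (S : Spec α) : Set (Rule α) := litRules S.F ∪ S.G

/-- `𝔗_Π`. -/
def ThStrict (S : Spec α) : Set (Lit α) := {l | Th S.strict l}

/-- `𝔗_{Π ∪ Δ}`. -/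
def ThAll (S : Spec α) : Set (Lit α) := {l | Th (S.strict ∪ S.D) l}

/-- `⟨A, L⟩` is an argument: `A` is a set of (ground instances of) defeasible
rules from `Δ` and `A ∪ Π` derives `L`. -/
def IsArgument (S : Spec α) (A : Set (Rule α)) (L : Lit α) : Prop :=
  A ⊆ S.D ∧ Th (A ∪ S.strict) L

/-- `H` is a simplified activation set for `⟨A, L⟩`:  `L ∈ 𝔗_{H ∪ A ∪ Π^G}`. -/
def SAct (S : Spec α) (A : Set (Rule α)) (L : Lit α) (H : Set (Lit α)) : Prop :=
  Th (litRules H ∪ A ∪ S.G) L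

/-- `H` is an activation set for `⟨A, L⟩`:
`L ∈ 𝔗_{𝔏 ∪ Π}` for some `𝔏 ⊆ 𝔗_{H ∪ A ∪ Π^G}`. -/
def Act (S : Spec α) (A : Set (Rule α)) (L : Lit α) (H : Set (Lit α)) : Prop :=
  ∃ Ls : Set (Lit α), Ls ⊆ {l | Th (litRules H ∪ A ∪ S.G) l} ∧
    Th (litRules Ls ∪ S.strict) L

/-- `H` is a minimal simplified activation set for `⟨A, L⟩`. -/
def MinSAct (S : Spec α) (A : Set (Rule α)) (L : Lit α) (H : Set (Lit α)) : Prop :=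
  S.SAct A L H ∧ ∀ H' ⊂ H, ¬ S.SAct A L H'

/-- `H` is a minimal activation set for `⟨A, L⟩`. -/
def MinAct (S : Spec α) (A : Set (Rule α)) (L : Lit α) (H : Set (Lit α)) : Prop :=
  S.Act A L H ∧ ∀ H' ⊂ H, ¬ S.Act A L H'

/-- Poole's original specificity relation `≲P1`. -/
def leP1 (S : Spec α) (X Y : Set (Rule α) × Lit α) : Prop :=
  S.IsArgument X.1 X.2 ∧ S.IsArgument Y.1 Y.2 ∧
    ∀ H ⊆ S.ThAll, S.SAct X.1 X.2 H → ¬ S.SAct Y.1 X.2 H → S.SAct Y.1 Y.2 H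

/-- The standard version `≲P2` of Poole's specificity. -/
def leP2 (S : Spec α) (X Y : Set (Rule α) × Lit α) : Prop :=
  S.IsArgument X.1 X.2 ∧ S.IsArgument Y.1 Y.2 ∧
    ∀ H ⊆ S.ThAll, S.SAct X.1 X.2 H → ¬ S.SAct ∅ X.2 H → S.SAct Y.1 Y.2 H

/-- The rather unflawed version `≲P3` of Poole's specificity. -/
def leP3 (S : Spec α) (X Y : Set (Rule α) × Lit α) : Prop :=
  S.IsArgument X.1 X.2 ∧ S.IsArgument Y.1 Y.2 ∧
    (Y.2 ∈ S.ThStrict → X.2 ∈ S.ThStrict) ∧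
    ∀ H ⊆ S.ThAll, S.SAct X.1 X.2 H → ¬ S.SAct ∅ X.2 H → S.SAct Y.1 Y.2 H

/-- The corrected specificity relation `≲CP`. -/
def leCP (S : Spec α) (X Y : Set (Rule α) × Lit α) : Prop :=
  S.IsArgument X.1 X.2 ∧ S.IsArgument Y.1 Y.2 ∧
    (X.2 ∈ S.ThStrict ∨
      (Y.2 ∉ S.ThStrict ∧
        ∀ H ⊆ S.ThStrict, S.Act X.1 X.2 H → S.Act Y.1 Y.2 H))

/-- `<P1 := ≲P1 \ ≳P1`. -/
def ltP1 (S : Spec α) (X Y : Set (Rule α) × Lit α) : Prop := S.leP1 X Y ∧ ¬ S.leP1 Y X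
/-- `<P2 := ≲P2 \ ≳P2`. -/
def ltP2 (S : Spec α) (X Y : Set (Rule α) × Lit α) : Prop := S.leP2 X Y ∧ ¬ S.leP2 Y X
/-- `<P3 := ≲P3 \ ≳P3`. -/
def ltP3 (S : Spec α) (X Y : Set (Rule α) × Lit α) : Prop := S.leP3 X Y ∧ ¬ S.leP3 Y X
/-- `<CP := ≲CP \ ≳CP`. -/
def ltCP (S : Spec α) (X Y : Set (Rule α) × Lit α) : Prop := S.leCP X Y ∧ ¬ S.leCP Y X

/-- `Π^{<2}`: rules of `Π` with at most one body literal. -/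
def strictLt2 (S : Spec α) : Set (Rule α) := {r ∈ S.strict | r.body.card ≤ 1}

/-- `Π^{≥2}`: rules of `Π` with at least two body literals. -/
def strictGe2 (S : Spec α) : Set (Rule α) := {r ∈ S.strict | 2 ≤ r.body.card}

/-- Condition 1 of Theorem 16. -/
def Cond1 (S : Spec α) : Prop :=
  ∀ H ⊆ S.ThStrict, ∀ A ⊆ S.D,
    {l | Th (litRules {l | Th (litRules H ∪ A ∪ S.G) l} ∪ S.strict) l} ⊆
      {l | Th (litRules H ∪ A ∪ S.G) l} ∪ S.ThStrict

/-- Condition 2 of Theorem 16. -/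
def Cond2 (S : Spec α) : Prop :=
  ∀ r ∈ S.strictGe2, r.head ∉ {l | Th S.strictLt2 l} →
    ∀ l ∈ r.body, l ∉ {l | Th S.strictLt2 l}

/-- Condition 3 of Theorem 16. -/
def Cond3 (S : Spec α) : Prop :=
  ∀ r ∈ S.strictGe2, ∀ l ∈ r.body, l ∉ S.ThStrict

/-- Condition 4 of Theorem 16. -/
def Cond4 (S : Spec α) : Prop := S.strictGe2 = ∅

end Spec

theorem Th.mono {α : Type} {P Q : Set (Rule α)} (h : P ⊆ Q) {l : Lit α} (hl : Th P l) :
    Th Q l := by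
  induction hl with
  | step r hr _ ih => exact Th.step r (h hr) ih

theorem litRules_mono {α : Type} {H K : Set (Lit α)} (h : H ⊆ K) : litRules H ⊆ litRules K :=
  fun _ hr => ⟨h hr.1, hr.2⟩

/-- Derivability is compact: a derivation uses only finitely many of the assumed literals. -/
theorem Th.exists_finset {α : Type} {H : Set (Lit α)} {P : Set (Rule α)} {l : Lit α}
    (hl : Th (litRules H ∪ P) l) :
    ∃ K : Finset (Lit α), (K : Set (Lit α)) ⊆ H ∧ Th (litRules (K : Set (Lit α)) ∪ P) l := by
  classical
  induction hl with
  | step r hr _ ih =>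
    rcases hr with hr | hr
    · refine ⟨{r.head}, by simpa using hr.1, Th.step r (Or.inl ⟨by simp, hr.2⟩) ?_⟩
      simp [hr.2]
    · choose! K hKH hK using ih
      refine ⟨r.body.biUnion K, ?_, Th.step r (Or.inr hr) fun l hl => (hK l hl).mono ?_⟩
      · simpa using hKH
      · exact Set.union_subset_union_left _
          (litRules_mono (Finset.coe_subset.2 (Finset.subset_biUnion_of_mem K hl)))

namespace Spec

theorem SAct.mono {α : Type} {S : Spec α} {A : Set (Rule α)} {L : Lit α} {H K : Set (Lit α)}
    (h : H ⊆ K) (hH : S.SAct A L H) : S.SAct A L K :=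
  Th.mono (Set.union_subset_union_left _ (Set.union_subset_union_left _ (litRules_mono h))) hH

theorem SAct.exists_minSAct_subset {α : Type} {S : Spec α} {A : Set (Rule α)} {L : Lit α}
    {H : Set (Lit α)} (hH : S.SAct A L H) : ∃ K ⊆ H, S.MinSAct A L K := by
  simp only [SAct, Set.union_assoc] at hH
  obtain ⟨K, hKH, hK⟩ := hH.exists_finset
  rw [← Set.union_assoc] at hK
  obtain ⟨M, hMK, hM⟩ := exists_minimal_le_of_wellFoundedLT
    (fun M : Finset (Lit α) => S.SAct A L (M : Set (Lit α))) K hK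
  refine ⟨M, (Finset.coe_subset.2 hMK).trans hKH, hM.prop, fun N hN hNA => ?_⟩
  lift N to Finset (Lit α) using M.finite_toSet.subset hN.subset
  exact hM.not_prop_of_lt (Finset.coe_ssubset.1 hN) hNA

end Spec

/-- Restricting the quantification in the definition of `≲P3` to minimal
simplified activation sets does not change the relation. -/
theorem leP3_iff_minimal {α : Type} (S : Spec α) (X Y : Set (Rule α) × Lit α) :
    S.leP3 X Y ↔
      (S.IsArgument X.1 X.2 ∧ S.IsArgument Y.1 Y.2 ∧
        (Y.2 ∈ S.ThStrict → X.2 ∈ S.ThStrict) ∧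
        ∀ H ⊆ S.ThAll, S.MinSAct X.1 X.2 H → ¬ S.SAct ∅ X.2 H →
          S.SAct Y.1 Y.2 H) := by
  refine and_congr_right fun _ => and_congr_right fun _ => and_congr_right fun _ =>
    ⟨fun h H hH hX => h H hH hX.1, fun h H hH hX hnot => ?_⟩
  obtain ⟨K, hKH, hK⟩ := hX.exists_minSAct_subset
  exact (h K (hKH.trans hH) hK fun hK' => hnot (hK'.mono hKH)).mono hKH
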